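/- arXiv:1508.03066 — 2 statements merged into one kernel-verified Lean document; each statement's English description precedes it below -/
import Mathlib

section
/- Let n ∈ ℕ and let H(ℂⁿ) denote the space of entire functions f : ℂⁿ → ℂ endowed with the compact-open topology. Let L : H(ℂⁿ) → H(ℂⁿ) be a continuous linear operator such that L(τ_a f) = τ_a(L f) for every f ∈ H(ℂⁿ) and every a ∈ ℂⁿ, where (τ_a f)(x) = f(x − a), and suppose L is not a scalar multiple of the identity. Then L is mixing, in particular hypercyclic. -/
open Filter Topology

/-- The space `H(ℂⁿ)` of entire functions on `ℂⁿ`, as a submodule of all functions. -/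
noncomputable def EntireSubmodule (n : ℕ) : Submodule ℂ ((Fin n → ℂ) → ℂ) where
  carrier := {f | Differentiable ℂ f}
  add_mem' hf hg := hf.add hg
  zero_mem' := differentiable_const 0
  smul_mem' c _f hf := hf.const_smul c

/-- The compact-open topology on `H(ℂⁿ)`, i.e. the topology of uniform convergence on
the compact subsets of `ℂⁿ`. -/
noncomputable instance entireTopology (n : ℕ) : TopologicalSpace (EntireSubmodule n) :=
  TopologicalSpace.induced
    (fun f => UniformOnFun.ofFun {K : Set (Fin n → ℂ) | IsCompact K}
      (f : (Fin n → ℂ) → ℂ))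
    inferInstance

/-- The translation operator `τ_a : f ↦ f (· − a)` on `H(ℂⁿ)`. -/
def translateE {n : ℕ} (a : Fin n → ℂ) (f : EntireSubmodule n) : EntireSubmodule n :=
  ⟨fun x => (f : (Fin n → ℂ) → ℂ) (x - a), f.2.comp (differentiable_id.sub_const a)⟩

namespace GS
variable {n : ℕ}

/-- Inclusion of entire functions into continuous functions. -/
noncomputable def toC (n : ℕ) : EntireSubmodule n →ₗ[ℂ] C(Fin n → ℂ, ℂ) where
  toFun f := ⟨f.1, Differentiable.continuous (𝕜 := ℂ) f.2⟩
  map_add' _ _ := rfl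
  map_smul' _ _ := rfl

@[simp] lemma toC_apply (f : EntireSubmodule n) (z) : toC n f z = f.1 z := rfl

lemma toC_ind : IsInducing (toC n) := by
  have h := (ContinuousMap.isUniformEmbedding_toUniformOnFunIsCompact
    (α := Fin n → ℂ) (β := ℂ)).isEmbedding.isInducing
  refine IsInducing.of_comp_iff h |>.1 ?_
  exact ⟨rfl⟩

lemma toC_inj : Function.Injective (toC n) := by
  intro f g h
  apply Subtype.ext
  funext z
  exact DFunLike.congr_fun h z

lemma toC_emb : IsEmbedding (toC n) := ⟨toC_ind, toC_inj⟩

instance : ContinuousAdd (EntireSubmodule n) := toC_ind.continuousAdd (toC n)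
instance : ContinuousConstSMul ℂ (EntireSubmodule n) :=
  toC_ind.continuousConstSMul id (fun {c x} => (toC n).map_smul c x)
instance : T2Space (EntireSubmodule n) := toC_emb.t2Space
instance : SecondCountableTopology (EntireSubmodule n) := toC_emb.secondCountableTopology
instance : IsTopologicalAddGroup (EntireSubmodule n) := topologicalAddGroup_induced (toC n) |> fun h => by
  rw [← toC_ind.eq_induced] at h; exact h
instance : ContinuousSMul ℂ (EntireSubmodule n) :=
  toC_ind.continuousSMul continuous_id (fun {c x} => (toC n).map_smul c x)

/-- Cauchy estimate -/
lemma fderiv_bound {g : (Fin n → ℂ) → ℂ} (hg : Differentiable ℂ g) (z : Fin n → ℂ) (M : ℝ)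
    (hM : ∀ x ∈ Metric.closedBall z 1, ‖g x‖ ≤ M) : ‖fderiv ℂ g z‖ ≤ M := by
  have hM0 : 0 ≤ M := (norm_nonneg _).trans (hM z (by simp))
  refine ContinuousLinearMap.opNorm_le_bound _ hM0 fun v => ?_
  by_cases hv : v = 0
  · simp [hv]
  have hv' : 0 < ‖v‖ := norm_pos_iff.2 hv
  have h1 : HasDerivAt (fun t : ℂ => g (z + t • v)) (fderiv ℂ g z v) 0 := by
    have h2 : HasDerivAt (fun t : ℂ => z + t • v) v 0 := by
      simpa using ((hasDerivAt_id (0 : ℂ)).smul_const v).const_add z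
    have h3 : HasFDerivAt g (fderiv ℂ g z) (z + (0 : ℂ) • v) := by
      simpa using (hg z).hasFDerivAt
    exact h3.comp_hasDerivAt (0 : ℂ) h2
  have hd : Differentiable ℂ (fun t : ℂ => g (z + t • v)) := by fun_prop
  have := Complex.norm_deriv_le_of_forall_mem_sphere_norm_le (c := 0) (R := ‖v‖⁻¹) (C := M)
    (f := fun t : ℂ => g (z + t • v)) (by positivity) hd.diffContOnCl ?_
  · rw [h1.deriv] at this
    simpa using this
  · intro t ht
    apply hM
    simp at ht
    simp [norm_smul, ht, hv'.ne']

lemma range_closed : IsClosed (Set.range (toC n)) := by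
  rw [← closure_subset_iff_isClosed]
  intro f hf
  obtain ⟨x, hx, hlim⟩ := mem_closure_iff_seq_limit.1 hf
  choose u hu using hx
  suffices hd : Differentiable ℂ (f : (Fin n → ℂ) → ℂ) from ⟨⟨f, hd⟩, rfl⟩
  have hlim' := ContinuousMap.tendsto_iff_forall_isCompact_tendstoUniformlyOn.1 hlim
  have hx : ∀ k, Differentiable ℂ (x k) := fun k => by rw [← hu]; exact (u k).2
  have hpt : ∀ y, Tendsto (fun k => x k y) atTop (𝓝 (f y)) := fun y =>
    (hlim' {y} isCompact_singleton).tendsto_at rfl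
  intro z
  have hC : UniformCauchySeqOn (fun k => fderiv ℂ (x k)) atTop (Metric.ball z 1) := by
    have h2 := (hlim' (Metric.closedBall z 2) (isCompact_closedBall z 2)).uniformCauchySeqOn
    rw [Metric.uniformCauchySeqOn_iff] at h2 ⊢
    intro ε hε
    obtain ⟨N, hN⟩ := h2 (ε / 2) (by positivity)
    refine ⟨N, fun k hk l hl y hy => ?_⟩
    rw [dist_eq_norm, ← fderiv_sub (hx k y) (hx l y)]
    refine (fderiv_bound ((hx k).sub (hx l)) y (ε / 2) ?_).trans_lt (by linarith)
    intro w hw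
    have := hN k hk l hl w (by
      rw [Metric.mem_closedBall] at *
      rw [Metric.mem_ball] at hy
      linarith [dist_triangle w y z])
    rw [dist_eq_norm] at this
    exact this.le
  have hex : ∀ y, ∃ G, y ∈ Metric.ball z 1 →
      Tendsto (fun k => fderiv ℂ (x k) y) atTop (𝓝 G) := by
    intro y
    by_cases hy : y ∈ Metric.ball z 1
    · obtain ⟨G, hG⟩ := cauchySeq_tendsto_of_complete (hC.cauchySeq hy)
      exact ⟨G, fun _ => hG⟩
    · exact ⟨0, fun h => absurd h hy⟩
  choose G hG using hex
  have hT := hC.tendstoUniformlyOn_of_tendsto (fun y hy => hG y hy)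
  exact (hasFDerivAt_of_tendstoUniformlyOn Metric.isOpen_ball hT
    (fun k y _ => (hx k y).hasFDerivAt) (fun y _ => hpt y) (Metric.mem_ball_self one_pos)).differentiableAt

lemma toC_closedEmb : IsClosedEmbedding (toC n) := ⟨toC_emb, range_closed⟩

instance : BaireSpace (EntireSubmodule n) := by
  let : UniformSpace C(Fin n → ℂ, ℂ) := inferInstance
  have : TopologicalSpace.IsCompletelyMetrizableSpace C(Fin n → ℂ, ℂ) := inferInstance
  have := (toC_closedEmb (n := n)).IsCompletelyMetrizableSpace
  infer_instance

lemma mem_closure_iff (S : Set (EntireSubmodule n)) (f : EntireSubmodule n)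
    (h : ∀ R > 0, ∀ ε > 0, ∃ g ∈ S, ∀ z ∈ Metric.closedBall (0 : Fin n → ℂ) R, ‖f.1 z - g.1 z‖ < ε) :
    f ∈ closure S := by
  have h1 : ∀ k : ℕ, ∃ g ∈ S, ∀ z ∈ Metric.closedBall (0 : Fin n → ℂ) (k + 1),
      ‖f.1 z - g.1 z‖ < 1 / ((k : ℝ) + 1) := fun k => h _ (by positivity) _ (by positivity)
  choose g hgS hg using h1
  refine mem_closure_of_tendsto (b := atTop) (f := g) ?_ (Eventually.of_forall hgS)
  rw [toC_ind.tendsto_nhds_iff, ContinuousMap.tendsto_iff_forall_isCompact_tendstoUniformlyOn]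
  intro K hK
  obtain ⟨R, hR⟩ := hK.isBounded.subset_closedBall 0
  rw [Metric.tendstoUniformlyOn_iff]
  intro ε hε
  have e1 : ∀ᶠ k : ℕ in atTop, 1 / ((k : ℝ) + 1) < ε :=
    tendsto_one_div_add_atTop_nhds_zero_nat.eventually_lt_const hε
  have e2 : ∀ᶠ k : ℕ in atTop, R ≤ (k : ℝ) := tendsto_natCast_atTop_atTop.eventually_ge_atTop R
  filter_upwards [e1, e2] with k hk1 hk2 z hz
  rw [dist_eq_norm]
  refine lt_trans (hg k z ?_) hk1
  exact Metric.closedBall_subset_closedBall (by linarith) (hR hz)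


/-- Polynomial functions on the closed polydisc of radius `R`. -/
noncomputable def polyK (n : ℕ) (R : ℝ) :
    MvPolynomial (Fin n) ℂ →ₐ[ℂ] C(Metric.closedBall (0 : Fin n → ℂ) R, ℂ) :=
  MvPolynomial.aeval fun i => ⟨fun z => z.1 i, (continuous_apply i).comp continuous_subtype_val⟩

lemma polyK_apply (R : ℝ) (p : MvPolynomial (Fin n) ℂ) (z : Metric.closedBall (0 : Fin n → ℂ) R) :
    polyK n R p z = MvPolynomial.eval z.1 p := by
  induction p using MvPolynomial.induction_on with
  | C a => simp [polyK]
  | add p q hp hq => simp [hp, hq]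
  | mul_X p i hp => simp [hp]; left; simp [polyK]

/-- The closure of polynomials in the space of continuous functions on the polydisc. -/
noncomputable def PK (n : ℕ) (R : ℝ) :
    Subalgebra ℂ C(Metric.closedBall (0 : Fin n → ℂ) R, ℂ) :=
  (polyK n R).range.topologicalClosure

/-- restriction to polydisc -/
noncomputable def res (R : ℝ) (f : C(Fin n → ℂ, ℂ)) : C(Metric.closedBall (0 : Fin n → ℂ) R, ℂ) :=
  f.restrict _

lemma weak_cauchy {F ι : Type*} [NormedAddCommGroup F] [NormedSpace ℂ F] [CompleteSpace F]
    (g : ℂ → F) (hg : Continuous g) (ev : ι → F →L[ℂ] ℂ)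
    (hsep : ∀ a b, (∀ i, ev i a = ev i b) → a = b)
    (hd : ∀ i, Differentiable ℂ fun w => ev i (g w)) (r : NNReal) (hr : 0 < r) :
    HasFPowerSeriesOnBall g (cauchyPowerSeries g 0 r) 0 r := by
  have hps := hasFPowerSeriesOn_cauchy_integral (f := g) (c := 0) (R := r)
    (hg.continuousOn.circleIntegrable r.2) hr
  refine hps.congr ?_
  intro w hw
  have hw : w ∈ Metric.ball (0 : ℂ) r := by simpa using hw
  refine hsep _ _ fun i => ?_
  rw [map_smul]
  have hint : ev i (∮ z in C(0, r), (z - w)⁻¹ • g z) = ∮ z in C(0, r), (z - w)⁻¹ • ev i (g z) := by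
    unfold circleIntegral
    rw [← ContinuousLinearMap.intervalIntegral_comp_comm]
    · simp only [map_smul]
    · refine CircleIntegrable.out (f := fun z => (z - w)⁻¹ • g z) ?_
      apply ContinuousOn.circleIntegrable r.2
      refine ContinuousOn.smul (ContinuousOn.inv₀ (by fun_prop) ?_) hg.continuousOn
      intro x hx h0
      rw [sub_eq_zero] at h0
      subst h0
      rw [Metric.mem_ball] at hw
      rw [mem_sphere_iff_norm, ← dist_eq_norm] at hx
      exact absurd hx hw.ne
  rw [hint]
  exact Complex.two_pi_I_inv_smul_circleIntegral_sub_inv_smul_of_differentiable_on_off_countable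
    Set.countable_empty hw (hd i).continuous.continuousOn (fun x _ => hd i x)

lemma poly_step (R : ℝ) (hR : 0 < R) (i : Fin n) (f : C(Fin n → ℂ, ℂ)) (hf : Differentiable ℂ f)
    (h : ∀ w : ℂ, res R (f.comp ⟨fun z => Function.update z i w, by fun_prop⟩) ∈ PK n R) :
    res R f ∈ PK n R := by
  have : CompactSpace (Metric.closedBall (0 : Fin n → ℂ) R) :=
    isCompact_iff_compactSpace.1 (isCompact_closedBall _ _)
  let A : Submodule ℂ C(Metric.closedBall (0 : Fin n → ℂ) R, ℂ) := Subalgebra.toSubmodule (PK n R)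
  have hAc : IsClosed (A : Set C(Metric.closedBall (0 : Fin n → ℂ) R, ℂ)) :=
    Subalgebra.isClosed_topologicalClosure _
  have : CompleteSpace A := hAc.completeSpace_coe
  let g : ℂ → A := fun w => ⟨_, h w⟩
  have hgz : ∀ w z, (g w).1 z = f (Function.update z.1 i w) := fun w z => rfl
  have hg : Continuous g := by
    refine Continuous.subtype_mk ?_ _
    refine ContinuousMap.continuous_of_continuous_uncurry _ ?_
    change Continuous fun q : ℂ × Metric.closedBall (0 : Fin n → ℂ) R => f (Function.update q.2.1 i q.1)
    fun_prop
  let r : NNReal := ⟨R + 1, by positivity⟩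
  have hr : 0 < r := by change (0 : ℝ) < R + 1; positivity
  let ev : Metric.closedBall (0 : Fin n → ℂ) R → A →L[ℂ] ℂ := fun z =>
    (ContinuousMap.evalCLM ℂ z).comp A.subtypeL
  have hps := weak_cauchy g hg ev (fun a b hab => Subtype.ext (ContinuousMap.ext hab)) (by
    intro z
    change Differentiable ℂ (fun w => f (Function.update z.1 i w))
    refine hf.comp ?_
    intro w
    exact (hasDerivAt_update z.1 i w).differentiableAt) r hr
  set p := cauchyPowerSeries g 0 r with hp
  let R' : NNReal := ⟨R + 1/2, by positivity⟩
  have hRR : (R' : ENNReal) < r := by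
    rw [ENNReal.coe_lt_coe]; change R + 1/2 < R + 1; linarith
  have hU := hps.tendstoUniformlyOn hRR
  rw [Metric.tendstoUniformlyOn_iff] at hU
  change _ ∈ (PK n R : Set C(Metric.closedBall (0 : Fin n → ℂ) R, ℂ))
  rw [← (show IsClosed (PK n R : Set C(Metric.closedBall (0 : Fin n → ℂ) R, ℂ)) from hAc).closure_eq,
    Metric.mem_closure_iff]
  intro ε hε
  obtain ⟨N, hN⟩ := (hU (ε / 2) (by positivity)).exists
  have hX : ∀ k, polyK n R (MvPolynomial.X i ^ k) ∈ PK n R := fun k =>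
    Subalgebra.le_topologicalClosure _ ⟨_, rfl⟩
  refine ⟨∑ k ∈ Finset.range N, polyK n R (MvPolynomial.X i ^ k) * (p.coeff k).1, ?_, ?_⟩
  · exact sum_mem fun k _ => mul_mem (hX k) (p.coeff k).2
  · refine lt_of_le_of_lt ((ContinuousMap.dist_le (by positivity)).2 ?_) (half_lt_self hε)
    intro z
    have hz : ‖z.1 i‖ ≤ R := (norm_le_pi_norm _ i).trans (mem_closedBall_zero_iff.1 z.2)
    have h1 := hN (z.1 i) (by
      simp only [Metric.mem_ball, dist_zero_right]; change ‖z.1 i‖ < R + 1/2; linarith)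
    rw [zero_add] at h1
    have h2 : dist ((g (z.1 i)).1 z) ((p.partialSum N (z.1 i)).1 z) ≤
        dist (g (z.1 i)) (p.partialSum N (z.1 i)) := ContinuousMap.dist_apply_le_dist z
    have h3 : (g (z.1 i)).1 z = res R f z := by
      rw [hgz, Function.update_eq_self]; rfl
    have h4 : (p.partialSum N (z.1 i)).1 z =
        (∑ k ∈ Finset.range N, polyK n R (MvPolynomial.X i ^ k) * (p.coeff k).1) z := by
      simp [FormalMultilinearSeries.partialSum, polyK_apply, ContinuousMap.sum_apply]
    rw [h3, h4] at h2
    exact h2.trans h1.le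

lemma poly_mem (R : ℝ) (hR : 0 < R) (s : Finset (Fin n)) : ∀ (f : C(Fin n → ℂ, ℂ)),
    Differentiable ℂ f → (∀ z z' : Fin n → ℂ, (∀ i ∈ s, z i = z' i) → f z = f z') →
    res R f ∈ PK n R := by
  induction s using Finset.induction_on with
  | empty =>
    intro f _ h
    have : res R f = polyK n R (MvPolynomial.C (f 0)) := by
      ext z
      rw [polyK_apply]
      rw [MvPolynomial.eval_C]
      exact h z.1 0 (by simp)
    rw [this]
    exact Subalgebra.le_topologicalClosure _ ⟨_, rfl⟩
  | insert i s his ih =>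
    intro f hf h
    refine poly_step R hR i f hf fun w => ih _ ?_ ?_
    · refine hf.comp ?_
      rw [differentiable_pi]
      intro j
      by_cases hj : j = i
      · subst hj; simp
      · simp [hj]; fun_prop
    · intro z z' hz
      apply h
      intro j hj
      by_cases hji : j = i
      · subst hji; simp
      · simp [hji]
        exact hz j (by simpa [hji] using hj)

/-- Polynomials as entire functions -/
noncomputable def polyE (p : MvPolynomial (Fin n) ℂ) : EntireSubmodule n :=
  ⟨fun z => MvPolynomial.eval z p, by
    change Differentiable ℂ _
    induction p using MvPolynomial.induction_on with
    | C a => simp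
    | add p q hp hq => simp only [map_add]; exact hp.add hq
    | mul_X p i hp => simp only [map_mul, MvPolynomial.eval_X]; fun_prop⟩

lemma poly_approx (f : EntireSubmodule n) (R : ℝ) (hR : 0 < R) (ε : ℝ) (hε : 0 < ε) :
    ∃ p : MvPolynomial (Fin n) ℂ, ∀ z ∈ Metric.closedBall (0 : Fin n → ℂ) R,
      ‖f.1 z - MvPolynomial.eval z p‖ < ε := by
  have : CompactSpace (Metric.closedBall (0 : Fin n → ℂ) R) :=
    isCompact_iff_compactSpace.1 (isCompact_closedBall _ _)
  have h := poly_mem R hR Finset.univ (toC n f) f.2 (fun z z' h => by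
    congr 1; ext i; exact h i (by simp))
  have h' : res R (toC n f) ∈ closure ((polyK n R).range : Set C(Metric.closedBall (0 : Fin n → ℂ) R, ℂ)) := h
  rw [Metric.mem_closure_iff] at h'
  obtain ⟨_, ⟨p, rfl⟩, hp⟩ := h' ε hε
  refine ⟨p, fun z hz => ?_⟩
  have := (ContinuousMap.dist_apply_le_dist (f := res R (toC n f)) (g := polyK n R p) ⟨z, hz⟩).trans_lt hp
  rw [polyK_apply, dist_eq_norm] at this
  exact this

/-- The linear form `z ↦ ∑ μ_i z_i`. -/
noncomputable def lin (μ z : Fin n → ℂ) : ℂ := ∑ i, μ i * z i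

lemma lin_diff (μ : Fin n → ℂ) : Differentiable ℂ (lin μ) := by
  unfold lin; fun_prop

lemma lin_cont : Continuous fun q : (Fin n → ℂ) × (Fin n → ℂ) => lin q.1 q.2 := by
  unfold lin; fun_prop

lemma lin_add (μ ν z : Fin n → ℂ) : lin (μ + ν) z = lin μ z + lin ν z := by
  simp [lin, add_mul, Finset.sum_add_distrib]

lemma lin_smul (t : ℂ) (μ z : Fin n → ℂ) : lin (t • μ) z = t * lin μ z := by
  simp [lin, mul_assoc, Finset.mul_sum]

lemma lin_sub_right (μ z w : Fin n → ℂ) : lin μ (z - w) = lin μ z - lin μ w := by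
  simp [lin, mul_sub, Finset.sum_sub_distrib]

lemma lin_zero_right (μ : Fin n → ℂ) : lin μ 0 = 0 := by
  simp [lin]

/-- Product of entire functions -/
def mulE (f g : EntireSubmodule n) : EntireSubmodule n :=
  ⟨fun z => f.1 z * g.1 z, Differentiable.mul (𝕜 := ℂ) f.2 g.2⟩

/-- Exponentials -/
noncomputable def expE (μ : Fin n → ℂ) : EntireSubmodule n :=
  ⟨fun z => Complex.exp (lin μ z), (lin_diff μ).cexp⟩

/-- linear forms -/
noncomputable def linE (μ : Fin n → ℂ) : EntireSubmodule n := ⟨lin μ, lin_diff μ⟩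

lemma expE_cont : Continuous (expE (n := n)) := by
  rw [toC_ind.continuous_iff]
  refine ContinuousMap.continuous_of_continuous_uncurry _ ?_
  exact Complex.continuous_exp.comp lin_cont

lemma exp_dq (μ ν : Fin n → ℂ) (g : EntireSubmodule n) :
    Tendsto (fun t : ℂ => t⁻¹ • (mulE (expE (μ + t • ν)) g - mulE (expE μ) g)) (𝓝[≠] 0)
      (𝓝 (mulE (mulE (linE ν) (expE μ)) g)) := by
  have hψ : Continuous (dslope Complex.exp 0) := by
    rw [continuous_iff_continuousAt]
    intro w
    by_cases hw : w = 0
    · subst hw; exact continuousAt_dslope_same.2 Complex.differentiable_exp.differentiableAt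
    · exact (continuousAt_dslope_of_ne hw).2 Complex.continuous_exp.continuousAt
  have hd : Differentiable ℂ (dslope Complex.exp 0) := by
    have := (Complex.differentiableOn_dslope (f := Complex.exp) (s := Set.univ) (c := 0)
      Filter.univ_mem).2 Complex.differentiable_exp.differentiableOn
    exact differentiableOn_univ.1 this
  let G : ℂ → EntireSubmodule n := fun t =>
    mulE (mulE ⟨fun z => lin ν z * dslope Complex.exp 0 (t * lin ν z),
      (lin_diff ν).mul (hd.comp ((lin_diff ν).const_mul t))⟩ (expE μ)) g
  have hG : Continuous G := by
    rw [toC_ind.continuous_iff]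
    refine ContinuousMap.continuous_of_continuous_uncurry _ ?_
    change Continuous fun q : ℂ × (Fin n → ℂ) =>
      lin ν q.2 * dslope Complex.exp 0 (q.1 * lin ν q.2) * Complex.exp (lin μ q.2) * g.1 q.2
    have h1 : Continuous (lin ν) := (lin_diff ν).continuous
    have h2 : Continuous (lin μ) := (lin_diff μ).continuous
    have h3 : Continuous g.1 := Differentiable.continuous (𝕜 := ℂ) g.2
    fun_prop
  have h0 : G 0 = mulE (mulE (linE ν) (expE μ)) g := by
    apply Subtype.ext; funext z
    simp [G, mulE, linE]
  rw [← h0]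
  refine (hG.continuousAt.tendsto.mono_left nhdsWithin_le_nhds).congr' ?_
  filter_upwards [self_mem_nhdsWithin] with t ht
  have ht : t ≠ 0 := ht
  apply Subtype.ext; funext z
  change lin ν z * dslope Complex.exp 0 (t * lin ν z) * Complex.exp (lin μ z) * g.1 z =
    t⁻¹ * (Complex.exp (lin (μ + t • ν) z) * g.1 z - Complex.exp (lin μ z) * g.1 z)
  rw [lin_add, lin_smul, Complex.exp_add]
  have key : (t * lin ν z) * dslope Complex.exp 0 (t * lin ν z) = Complex.exp (t * lin ν z) - 1 := by
    have := sub_smul_dslope Complex.exp 0 (t * lin ν z)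
    simpa using this
  rw [eq_inv_mul_iff_mul_eq₀ ht]
  linear_combination (Complex.exp (lin μ z) * g.1 z) * key

lemma one_mulE (μ : Fin n → ℂ) : mulE (expE μ) (polyE 1) = expE μ := by
  apply Subtype.ext; funext z; simp [mulE, polyE]

lemma exp_poly_mem (U : Set (Fin n → ℂ)) (hU : IsOpen U) (M : Submodule ℂ (EntireSubmodule n))
    (hMc : IsClosed (M : Set (EntireSubmodule n))) (hM : ∀ μ ∈ U, expE μ ∈ M)
    (p : MvPolynomial (Fin n) ℂ) : ∀ μ ∈ U, mulE (expE μ) (polyE p) ∈ M := by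
  induction p using MvPolynomial.induction_on with
  | C a =>
    intro μ hμ
    have : mulE (expE μ) (polyE (MvPolynomial.C a)) = a • expE μ := by
      apply Subtype.ext; funext z; simp [mulE, polyE, mul_comm]
    rw [this]; exact M.smul_mem _ (hM μ hμ)
  | add p q hp hq =>
    intro μ hμ
    have : mulE (expE μ) (polyE (p + q)) = mulE (expE μ) (polyE p) + mulE (expE μ) (polyE q) := by
      apply Subtype.ext; funext z; simp [mulE, polyE, mul_add]
    rw [this]; exact M.add_mem (hp μ hμ) (hq μ hμ)
  | mul_X p i hp =>
    intro μ hμ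
    have : mulE (expE μ) (polyE (p * MvPolynomial.X i)) =
        mulE (mulE (linE (Pi.single i 1)) (expE μ)) (polyE p) := by
      apply Subtype.ext; funext z
      simp [mulE, polyE, linE, lin, Pi.single_apply]
      ring
    rw [this]
    refine hMc.mem_of_tendsto (exp_dq μ (Pi.single i 1) (polyE p)) ?_
    have hc : ContinuousAt (fun t : ℂ => μ + t • (Pi.single i 1 : Fin n → ℂ)) 0 := by fun_prop
    have hev : ∀ᶠ t : ℂ in 𝓝[≠] 0, μ + t • (Pi.single i 1 : Fin n → ℂ) ∈ U :=
      nhdsWithin_le_nhds (hc (hU.mem_nhds (by simpa using hμ)))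
    filter_upwards [hev] with t ht
    exact M.smul_mem _ (M.sub_mem (hp _ ht) (hp _ hμ))

lemma exp_dense (U : Set (Fin n → ℂ)) (hU : IsOpen U) (hne : U.Nonempty)
    (M : Submodule ℂ (EntireSubmodule n)) (hM : ∀ μ ∈ U, expE μ ∈ M) :
    Dense (M : Set (EntireSubmodule n)) := by
  obtain ⟨μ, hμ⟩ := hne
  intro f
  rw [← closure_closure]
  have hcl := exp_poly_mem U hU M.topologicalClosure M.isClosed_topologicalClosure
    (fun μ h => M.le_topologicalClosure (hM μ h))
  apply mem_closure_iff
  intro R hR ε hε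
  obtain ⟨C, hC⟩ := (isCompact_closedBall (0 : Fin n → ℂ) R).exists_bound_of_continuousOn
    (f := (expE μ).1) (Differentiable.continuous (𝕜 := ℂ) (expE μ).2).continuousOn
  have hCp : 0 < |C| + 1 := by positivity
  obtain ⟨p, hp⟩ := poly_approx (mulE (expE (-μ)) f) R hR (ε / (|C| + 1)) (by positivity)
  refine ⟨_, hcl p μ hμ, fun z hz => ?_⟩
  have h1 := hp z hz
  have h2 : f.1 z - (mulE (expE μ) (polyE p)).1 z =
      (expE μ).1 z * ((mulE (expE (-μ)) f).1 z - MvPolynomial.eval z p) := by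
    have : Complex.exp (lin μ z) * Complex.exp (lin (-μ) z) = 1 := by
      rw [← Complex.exp_add, ← lin_add]; simp [lin]
    change f.1 z - Complex.exp (lin μ z) * MvPolynomial.eval z p =
      Complex.exp (lin μ z) * (Complex.exp (lin (-μ) z) * f.1 z - MvPolynomial.eval z p)
    linear_combination -(f.1 z) * this
  rw [h2, norm_mul]
  calc _ ≤ (|C| + 1) * ‖(mulE (expE (-μ)) f).1 z - MvPolynomial.eval z p‖ := by
        gcongr
        linarith [hC z hz, le_abs_self C]
    _ < (|C| + 1) * (ε / (|C| + 1)) := by gcongr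
    _ = ε := by field_simp

/-- Mixing implies a dense orbit. -/
lemma birkhoff {X : Type*} [TopologicalSpace X] [SecondCountableTopology X] [BaireSpace X]
    [Nonempty X] (T : X → X) (hT : Continuous T)
    (h : ∀ U V : Set X, IsOpen U → IsOpen V → U.Nonempty → V.Nonempty →
      ∃ n₀ : ℕ, ∀ k ≥ n₀, (T^[k] '' U ∩ V).Nonempty) :
    ∃ x, Dense (Set.range fun k : ℕ => T^[k] x) := by
  let B := TopologicalSpace.countableBasis X
  have hB := TopologicalSpace.isBasis_countableBasis X
  have hd : Dense (⋂ V ∈ B, ⋃ k : ℕ, T^[k] ⁻¹' V) := by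
    refine dense_biInter_of_isOpen ?_ (TopologicalSpace.countable_countableBasis X) ?_
    · intro V hV
      exact isOpen_iUnion fun k => (hB.isOpen hV).preimage (hT.iterate k)
    · intro V hV
      rw [dense_iff_inter_open]
      intro U hU hUne
      obtain ⟨k, hk⟩ := h U V hU (hB.isOpen hV) hUne (TopologicalSpace.nonempty_of_mem_countableBasis hV)
      obtain ⟨_, ⟨x, hx, rfl⟩, hxV⟩ := hk k le_rfl
      exact ⟨x, hx, Set.mem_iUnion.2 ⟨k, hxV⟩⟩
  obtain ⟨x, hx⟩ := hd.nonempty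
  refine ⟨x, hB.dense_iff.2 fun V hV _ => ?_⟩
  obtain ⟨k, hk⟩ := Set.mem_iUnion.1 (Set.mem_iInter₂.1 hx V hV)
  exact ⟨_, hk, k, rfl⟩

/-- Kitai's criterion. -/
lemma kitai {X : Type*} [AddCommGroup X] [Module ℂ X] [TopologicalSpace X] [ContinuousAdd X]
    [ContinuousConstSMul ℂ X] (L : X →ₗ[ℂ] X)
    (hX : ∀ M : Submodule ℂ X, (∀ x, Tendsto (fun k => L^[k] x) atTop (𝓝 0) → x ∈ M) →
      Dense (M : Set X))
    (hY : ∀ M : Submodule ℂ X, (∀ y, (∃ s : ℕ → X, Tendsto s atTop (𝓝 0) ∧ ∀ k, L^[k] (s k) = y) →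
      y ∈ M) → Dense (M : Set X)) (U V : Set X) (hU : IsOpen U) (hV : IsOpen V)
    (hUne : U.Nonempty) (hVne : V.Nonempty) :
    ∃ n₀ : ℕ, ∀ k ≥ n₀, (L^[k] '' U ∩ V).Nonempty := by
  have hadd : ∀ k (x y : X), L^[k] (x + y) = L^[k] x + L^[k] y := fun k x y => by
    rw [← Module.End.coe_pow, map_add]
  have hsmul : ∀ k (c : ℂ) (x : X), L^[k] (c • x) = c • L^[k] x := fun k c x => by
    rw [← Module.End.coe_pow, map_smul]
  have hzero : ∀ k, L^[k] (0 : X) = 0 := fun k => by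
    rw [← Module.End.coe_pow, map_zero]
  let M : Submodule ℂ X :=
    { carrier := {x | Tendsto (fun k => L^[k] x) atTop (𝓝 0)}
      add_mem' := fun {x y} hx hy => by
        have := Tendsto.add hx hy
        simpa only [Set.mem_ofPred_eq, hadd, add_zero] using this
      zero_mem' := by simp only [Set.mem_ofPred_eq, hzero]; exact tendsto_const_nhds
      smul_mem' := fun c x hx => by
        have := Tendsto.const_smul hx c
        simpa only [Set.mem_ofPred_eq, hsmul, smul_zero] using this }
  let M' : Submodule ℂ X :=
    { carrier := {y | ∃ s : ℕ → X, Tendsto s atTop (𝓝 0) ∧ ∀ k, L^[k] (s k) = y}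
      add_mem' := by
        rintro x y ⟨s, hs, hs'⟩ ⟨t, ht, ht'⟩
        refine ⟨fun k => s k + t k, by simpa using hs.add ht, fun k => ?_⟩
        rw [hadd, hs', ht']
      zero_mem' := ⟨fun _ => 0, tendsto_const_nhds, hzero⟩
      smul_mem' := by
        rintro c x ⟨s, hs, hs'⟩
        refine ⟨fun k => c • s k, by simpa using hs.const_smul c, fun k => ?_⟩
        rw [hsmul, hs'] }
  obtain ⟨x, hxU, hx⟩ := (hX M fun x hx => hx).inter_open_nonempty U hU hUne
  obtain ⟨y, hyV, s, hs, hs'⟩ := (hY M' fun x hx => hx).inter_open_nonempty V hV hVne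
  have hx : Tendsto (fun k => L^[k] x) atTop (𝓝 0) := hx
  have t1 : Tendsto (fun k => x + s k) atTop (𝓝 x) := by simpa using hs.const_add x
  have t2 : Tendsto (fun k => L^[k] x + y) atTop (𝓝 y) := by simpa using hx.add_const y
  obtain ⟨N, hN⟩ := eventually_atTop.1
    ((t1.eventually (hU.mem_nhds hxU)).and (t2.eventually (hV.mem_nhds hyV)))
  refine ⟨N, fun k hk => ⟨L^[k] x + y, ⟨x + s k, (hN k hk).1, ?_⟩, (hN k hk).2⟩⟩
  rw [hadd, hs']

/-- Liouville along lines. -/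
lemma liouville_lines (φ : (Fin n → ℂ) → ℂ)
    (hφ : ∀ μ ν, Differentiable ℂ fun t : ℂ => φ (μ + t • ν)) (C : ℝ) (hC : ∀ μ, ‖φ μ‖ ≤ C) :
    ∀ μ, φ μ = φ 0 := by
  intro μ
  have := (hφ 0 μ).apply_eq_apply_of_bounded (isBounded_iff_forall_norm_le.2
    ⟨C, by rintro _ ⟨t, rfl⟩; exact hC _⟩) 1 0
  simpa using this

end GS

theorem stmt13 (n : ℕ) (L : EntireSubmodule n →ₗ[ℂ] EntireSubmodule n)
    (hLcont : Continuous L)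
    (hconv : ∀ (a : Fin n → ℂ) (f : EntireSubmodule n),
      L (translateE a f) = translateE a (L f))
    (hnontriv : ¬ ∃ c : ℂ, ∀ f : EntireSubmodule n, L f = c • f) :
    (∀ U V : Set (EntireSubmodule n), IsOpen U → IsOpen V → U.Nonempty → V.Nonempty →
      ∃ n₀ : ℕ, ∀ k ≥ n₀, ((⇑L)^[k] '' U ∩ V).Nonempty) ∧
    ∃ f : EntireSubmodule n, Dense (Set.range fun k : ℕ => (⇑L)^[k] f) := by
  suffices hmix : ∀ U V : Set (EntireSubmodule n), IsOpen U → IsOpen V → U.Nonempty → V.Nonempty →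
      ∃ n₀ : ℕ, ∀ k ≥ n₀, ((⇑L)^[k] '' U ∩ V).Nonempty from
    ⟨hmix, GS.birkhoff L hLcont hmix⟩
  let φ : (Fin n → ℂ) → ℂ := fun μ => (L (GS.expE μ)).1 0
  have hev : Continuous fun f : EntireSubmodule n => f.1 0 :=
    (continuous_eval_const (F := C(Fin n → ℂ, ℂ)) (0 : Fin n → ℂ)).comp GS.toC_ind.continuous
  have hφc : Continuous φ := hev.comp (hLcont.comp GS.expE_cont)
  -- exponentials are eigenvectors
  have heig : ∀ μ, L (GS.expE μ) = φ μ • GS.expE μ := by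
    intro μ
    apply Subtype.ext; funext z
    have h1 : translateE (-z) (GS.expE μ) = Complex.exp (GS.lin μ z) • GS.expE μ := by
      apply Subtype.ext; funext w
      change Complex.exp (GS.lin μ (w - -z)) = Complex.exp (GS.lin μ z) * Complex.exp (GS.lin μ w)
      rw [← Complex.exp_add, GS.lin_sub_right]
      congr 1
      simp [GS.lin, Finset.sum_neg_distrib]
      ring
    have h2 := hconv (-z) (GS.expE μ)
    rw [h1, map_smul] at h2
    have h3 := congrFun (congrArg Subtype.val h2) 0
    change Complex.exp (GS.lin μ z) * φ μ = (L (GS.expE μ)).1 (0 - -z) at h3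
    rw [zero_sub, neg_neg] at h3
    rw [← h3]
    exact mul_comm _ _
  have hφd : ∀ μ ν, Differentiable ℂ fun t : ℂ => φ (μ + t • ν) := by
    intro μ ν t
    have h1 := GS.exp_dq (μ + t • ν) ν (GS.polyE 1)
    have h2 := ((hev.comp hLcont).tendsto _).comp h1
    refine HasDerivAt.differentiableAt (hasDerivAt_iff_tendsto_slope_zero.2 (h2.congr ?_))
    intro h
    simp only [Function.comp, GS.one_mulE, map_smul, map_sub]
    change h⁻¹ * (φ _ - φ _) = h⁻¹ * (φ _ - φ _)
    rw [add_smul, add_assoc]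
  have hnc : ∀ c, ¬ ∀ μ, φ μ = c := by
    intro c hc
    apply hnontriv
    refine ⟨c, fun f => ?_⟩
    let M : Submodule ℂ (EntireSubmodule n) := LinearMap.eqLocus L (c • LinearMap.id)
    have hM : Dense (M : Set (EntireSubmodule n)) := GS.exp_dense Set.univ isOpen_univ ⟨0, trivial⟩ M
      (fun μ _ => by change L _ = c • _; rw [heig, hc]; rfl)
    have hcl : IsClosed (M : Set (EntireSubmodule n)) :=
      isClosed_eq hLcont (continuous_const_smul c)
    have : f ∈ (M : Set (EntireSubmodule n)) := by
      rw [← hcl.closure_eq, hM.closure_eq]; trivial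
    exact this
  have hsmall : ∃ μ, ‖φ μ‖ < 1 := by
    by_contra! hcon
    have h0 : ∀ μ, φ μ ≠ 0 := fun μ h => by have := hcon μ; rw [h] at this; norm_num at this
    have := GS.liouville_lines (fun μ => (φ μ)⁻¹) (fun μ ν => (hφd μ ν).inv fun t => h0 _) 1
      (fun μ => by rw [norm_inv]; exact inv_le_one_of_one_le₀ (hcon μ))
    exact hnc (φ 0) fun μ => inv_injective (this μ)
  have hlarge : ∃ μ, 1 < ‖φ μ‖ := by
    by_contra! hcon
    exact hnc _ (GS.liouville_lines φ hφd 1 hcon)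
  have hpow : ∀ μ k, (⇑L)^[k] (GS.expE μ) = φ μ ^ k • GS.expE μ := by
    intro μ k
    induction k with
    | zero => simp
    | succ k ih => rw [Function.iterate_succ_apply', ih, map_smul, heig, smul_smul, pow_succ]
  have hsm : ∀ (c : ℂ) (μ : Fin n → ℂ), ‖c‖ < 1 →
      Tendsto (fun k : ℕ => c ^ k • GS.expE μ) atTop (𝓝 0) := by
    intro c μ hc
    have := (tendsto_pow_atTop_nhds_zero_of_norm_lt_one hc).smul_const (GS.expE μ)
    simpa using this
  apply GS.kitai
  · intro M hM
    refine GS.exp_dense {μ | ‖φ μ‖ < 1} (isOpen_lt hφc.norm continuous_const) hsmall M ?_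
    intro μ hμ
    apply hM
    simp only [hpow]
    exact hsm _ μ hμ
  · intro M hM
    refine GS.exp_dense {μ | 1 < ‖φ μ‖} (isOpen_lt continuous_const hφc.norm) hlarge M ?_
    intro μ hμ
    have hμ : 1 < ‖φ μ‖ := hμ
    have h0 : φ μ ≠ 0 := fun h => by rw [h] at hμ; norm_num at hμ
    refine hM _ ⟨fun k => (φ μ)⁻¹ ^ k • GS.expE μ, hsm _ μ ?_, fun k => ?_⟩
    · rw [norm_inv]; exact inv_lt_one_of_one_lt₀ hμ
    · rw [← Module.End.coe_pow, map_smul, Module.End.coe_pow, hpow, smul_smul, ← mul_pow,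
        inv_mul_cancel₀ h0, one_pow, one_smul]
end

section
/- Let n ∈ ℕ and let H(ℂⁿ) denote the space of entire functions f : ℂⁿ → ℂ endowed with the compact-open topology. For every nonempty open set U ⊆ ℂⁿ, the linear span of the exponential functions { x ↦ exp(λ₁x₁ + ⋯ + λₙxₙ) : λ = (λ₁, …, λₙ) ∈ U } is dense in H(ℂⁿ). -/
open Complex Metric Real in
/-- Cauchy expansion of a continuous Banach-valued function which is entire after
composition with suitable functionals. -/
theorem aux_banach {E : Type*} [NormedAddCommGroup E] [NormedSpace ℂ E] [CompleteSpace E]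
    (G : ℂ → E) (hG : Continuous G) (R : ℝ) (hR0 : 0 < R) :
    ∃ c : ℕ → E, (∃ C : ℝ, ∀ k, ‖c k‖ ≤ C * R⁻¹ ^ k) ∧
      ∀ L : E →L[ℂ] ℂ, Differentiable ℂ (fun z => L (G z)) → ∀ w : ℂ, ‖w‖ < R →
        HasSum (fun k => w ^ k * L (c k)) (L (G w)) := by
  have hci : CircleIntegrable G 0 R := hG.continuousOn.circleIntegrable hR0.le
  have hcw : ∀ k w, (cauchyPowerSeries G 0 R k fun _ => w) =
      w ^ k • (cauchyPowerSeries G 0 R k fun _ => 1) := by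
    intro k w
    simp [cauchyPowerSeries]
  refine ⟨fun k => cauchyPowerSeries G 0 R k fun _ => 1,
    ⟨(2 * π)⁻¹ * ∫ θ : ℝ in 0..2 * π, ‖G (circleMap 0 R θ)‖, fun k => ?_⟩, ?_⟩
  · have := norm_cauchyPowerSeries_le G 0 R k
    rw [abs_of_pos hR0] at this
    refine le_trans ?_ this
    have h := (cauchyPowerSeries G 0 R k).le_opNorm (fun _ => 1)
    simp only [norm_one, Finset.prod_const_one, mul_one] at h
    exact h
  · intro L hd w hw
    have h2 := hasSum_cauchyPowerSeries_integral hci hw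
    rw [show (fun k => cauchyPowerSeries G 0 R k fun _ => w) = _ from
      funext fun k => hcw k w] at h2
    have h3 := h2.mapL L
    have h4 : L ((2 * π * I : ℂ)⁻¹ • ∮ z in C(0, R), (z - (0 + w))⁻¹ • G z) = L (G w) := by
      rw [← two_pi_I_inv_smul_circleIntegral_sub_inv_smul_of_differentiable_on_off_countable
        (R := R) (c := 0) (w := w) (s := ∅) (f := fun z => L (G z)) Set.countable_empty
        (by simpa using hw) hd.continuous.continuousOn (fun y _ => hd y)]
      rw [map_smul]
      congr 1
      rw [zero_add]
      have hint : CircleIntegrable (fun z => (z - w)⁻¹ • G z) 0 R := by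
        refine ContinuousOn.circleIntegrable hR0.le ?_
        refine ContinuousOn.smul (ContinuousOn.inv₀ (by fun_prop) ?_) hG.continuousOn
        intro z hz h0
        rw [sub_eq_zero] at h0
        rw [h0] at hz
        simp at hz
        linarith
      rw [circleIntegral, circleIntegral,
        ← ContinuousLinearMap.intervalIntegral_comp_comm _ hint.out]
      simp
    rw [h4] at h3
    simpa only [map_smul, smul_eq_mul] using h3

/-- Key one-variable lemma with parameters: the Cauchy expansion in one coordinate,
with values in a closed subalgebra of `C(K, ℂ)`. -/
theorem aux_cauchy {K : Type*} [TopologicalSpace K] [CompactSpace K]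
    (A : Subalgebra ℂ C(K, ℂ)) (hA : IsClosed (A : Set C(K, ℂ)))
    (X : C(K, ℂ)) (hX : X ∈ A) (F : ℂ → C(K, ℂ)) (hF : Continuous F)
    (hFA : ∀ z, F z ∈ A) (hd : ∀ x, Differentiable ℂ (fun z => F z x))
    (g : C(K, ℂ)) (hg : ∀ x, g x = F (X x) x) : g ∈ A := by
  let S : Submodule ℂ C(K, ℂ) := Subalgebra.toSubmodule A
  have hS : IsClosed (S : Set C(K, ℂ)) := hA
  have : CompleteSpace S := hS.completeSpace_coe
  set R : ℝ := ‖X‖ + 1 with hR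
  have hR0 : 0 < R := by positivity
  obtain ⟨c, ⟨C, hC⟩, hL⟩ := aux_banach (E := S) (fun z => ⟨F z, hFA z⟩)
    (hF.subtype_mk _) R hR0
  have hsum : Summable (fun k => (c k : C(K, ℂ)) * X ^ k) := by
    have h1 : ‖X‖ / R < 1 := by rw [div_lt_one hR0]; linarith
    refine Summable.of_norm_bounded (g := fun k => C * (‖X‖ / R) ^ k)
      ((summable_geometric_of_lt_one (by positivity) h1).mul_left _) ?_
    intro k
    have h2 : ‖X ^ k‖ ≤ ‖X‖ ^ k := by
      rw [ContinuousMap.norm_le _ (by positivity)]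
      intro x
      rw [ContinuousMap.pow_apply, norm_pow]
      gcongr
      exact X.norm_coe_le_norm x
    have h3 : ‖(c k : C(K, ℂ))‖ ≤ C * R⁻¹ ^ k := hC k
    calc ‖(c k : C(K, ℂ)) * X ^ k‖ ≤ ‖(c k : C(K, ℂ))‖ * ‖X ^ k‖ := norm_mul_le _ _
      _ ≤ (C * R⁻¹ ^ k) * ‖X‖ ^ k := mul_le_mul h3 h2 (norm_nonneg _) ((norm_nonneg _).trans h3)
      _ = _ := by rw [div_pow, inv_pow]; ring
  have hval : g = ∑' k, (c k : C(K, ℂ)) * X ^ k := by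
    ext x
    let L : C(K, ℂ) →L[ℂ] ℂ := ContinuousMap.evalCLM ℂ x
    have h1 : HasSum (fun k => L ((c k : C(K, ℂ)) * X ^ k))
        (L (∑' k, (c k : C(K, ℂ)) * X ^ k)) := hsum.hasSum.mapL L
    have hw : ‖X x‖ < R := by have := X.norm_coe_le_norm x; linarith
    have h3 := hL (L.comp S.subtypeL) (hd x) (X x) hw
    rw [hg]
    refine h3.unique ?_
    convert! h1 using 2 with k
    exact mul_comm _ _
  rw [hval]
  refine hA.mem_of_tendsto hsum.hasSum (Filter.Eventually.of_forall fun s => ?_)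
  exact A.sum_mem fun k _ => A.mul_mem (c k).2 (A.pow_mem hX k)

/-- Restriction of entire functions to a subset. -/
noncomputable def restr (n : ℕ) (K : Set (Fin n → ℂ)) :
    EntireSubmodule n →ₗ[ℂ] C(K, ℂ) where
  toFun f := ⟨fun x => (f : (Fin n → ℂ) → ℂ) x,
    (show Differentiable ℂ (f : (Fin n → ℂ) → ℂ) from f.2).continuous.comp continuous_subtype_val⟩
  map_add' _ _ := rfl
  map_smul' _ _ := rfl

/-- Coordinate functions. -/
def coordK {n : ℕ} (K : Set (Fin n → ℂ)) (i : Fin n) : C(K, ℂ) :=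
  ⟨fun x => x.1 i, (continuous_apply i).comp continuous_subtype_val⟩

/-- Closed algebra generated by the coordinates. -/
noncomputable def polyAlg {n : ℕ} (K : Set (Fin n → ℂ)) [CompactSpace K] : Subalgebra ℂ C(K, ℂ) :=
  (Algebra.adjoin ℂ (Set.range (coordK K))).topologicalClosure

theorem coordK_mem {n : ℕ} (K : Set (Fin n → ℂ)) [CompactSpace K] (i : Fin n) : coordK K i ∈ polyAlg K :=
  Subalgebra.le_topologicalClosure _ (Algebra.subset_adjoin ⟨i, rfl⟩)

theorem entire_mem {n : ℕ} (K : Set (Fin n → ℂ)) [CompactSpace K] (s : Finset (Fin n)) :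
    ∀ f : EntireSubmodule n,
      (∀ x y : Fin n → ℂ, (∀ i ∈ s, x i = y i) →
        (f : (Fin n → ℂ) → ℂ) x = (f : (Fin n → ℂ) → ℂ) y) →
      restr n K f ∈ polyAlg K := by
  induction s using Finset.induction_on with
  | empty =>
    intro f hf
    have : restr n K f = algebraMap ℂ C(K, ℂ) ((f : (Fin n → ℂ) → ℂ) 0) := by
      ext x
      exact hf _ _ (by simp)
    rw [this]
    exact Subalgebra.algebraMap_mem _ _
  | insert i s hi ih =>
    intro f hf
    have hfd : Differentiable ℂ (f : (Fin n → ℂ) → ℂ) := f.2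
    let D : ℂ → EntireSubmodule n := fun z =>
      ⟨fun x => (f : (Fin n → ℂ) → ℂ) (Function.update x i z), by
        change Differentiable ℂ _
        refine hfd.comp ?_
        rw [differentiable_pi]
        intro j
        by_cases h : j = i
        · subst h; simp
        · simp only [Function.update_of_ne h]; fun_prop⟩
    refine aux_cauchy (polyAlg K) (Subalgebra.isClosed_topologicalClosure _) (coordK K i)
      (coordK_mem K i) (fun z => restr n K (D z)) ?_ ?_ ?_ _ ?_
    · refine ContinuousMap.continuous_of_continuous_uncurry _ ?_
      change Continuous fun p : ℂ × K => (f : (Fin n → ℂ) → ℂ) (Function.update p.2.1 i p.1)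
      exact hfd.continuous.comp (by fun_prop)
    · intro z
      apply ih
      intro x y h
      apply hf
      intro j hj
      by_cases h' : j = i
      · subst h'; simp
      · simp only [Function.update_of_ne h']
        exact h j (by simpa [h'] using hj)
    · intro x
      change Differentiable ℂ fun z => (f : (Fin n → ℂ) → ℂ) (Function.update x.1 i z)
      refine hfd.comp ?_
      rw [differentiable_pi]
      intro j
      by_cases h : j = i
      · subst h; simp
      · simp only [Function.update_of_ne h]; fun_prop
    · intro x
      change (f : (Fin n → ℂ) → ℂ) x.1 = (f : (Fin n → ℂ) → ℂ) (Function.update x.1 i (x.1 i))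
      simp

/-- The exponential `e_l`. -/
noncomputable def expE (n : ℕ) (l : Fin n → ℂ) : EntireSubmodule n :=
  ⟨fun x => Complex.exp (∑ i, l i * x i), by change Differentiable ℂ _; fun_prop⟩

theorem deriv_step {n : ℕ} (K : Set (Fin n → ℂ)) [CompactSpace K]
    (V : Submodule ℂ C(K, ℂ)) (hV : IsClosed (V : Set C(K, ℂ)))
    (U : Set (Fin n → ℂ)) (hU : IsOpen U) (p : C(K, ℂ))
    (hp : ∀ l ∈ U, restr n K (expE n l) * p ∈ V) (i : Fin n) :
    ∀ l ∈ U, restr n K (expE n l) * (coordK K i * p) ∈ V := by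
  intro l hl
  have h1 : HasDerivAt (fun u : ℂ => NormedSpace.exp (u • coordK K i)) (coordK K i) 0 := by
    simpa using hasDerivAt_exp_smul_const (coordK K i) (0 : ℂ)
  have h2 := (h1.const_mul (restr n K (expE n l))).mul_const p
  have h3 : ∀ u : ℂ, restr n K (expE n l) * NormedSpace.exp (u • coordK K i) =
      restr n K (expE n (l + Pi.single i u)) := by
    intro u
    ext x
    have h4 : (NormedSpace.exp (u • coordK K i) : C(K, ℂ)) x = Complex.exp (u * x.1 i) := by
      have := NormedSpace.map_exp (ContinuousMap.evalAlgHom ℂ ℂ x)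
        (ContinuousMap.evalCLM ℂ x).continuous (u • coordK K i)
      rw [Complex.exp_eq_exp_ℂ]
      exact this
    rw [ContinuousMap.mul_apply, h4]
    change Complex.exp (∑ j, l j * x.1 j) * _ = Complex.exp (∑ j, (l + Pi.single i u : Fin n → ℂ) j * x.1 j)
    rw [← Complex.exp_add]
    simp [add_mul, Finset.sum_add_distrib, Pi.single_apply]
  simp only [h3] at h2
  rw [mul_assoc] at h2
  rw [hasDerivAt_iff_tendsto_slope] at h2
  refine hV.mem_of_tendsto h2 ?_
  have hc : ContinuousAt (fun u : ℂ => l + Pi.single i u) 0 := by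
    have : Continuous (fun u : ℂ => l + Pi.single i u) := by
      exact continuous_const.add (continuous_single (A := fun _ : Fin n => ℂ) i)
    exact this.continuousAt
  have hev : ∀ᶠ u in nhds (0 : ℂ), l + Pi.single i u ∈ U :=
    hc.eventually_mem (hU.mem_nhds (by simpa using hl))
  filter_upwards [nhdsWithin_le_nhds hev] with u hu
  rw [slope_def_module]
  refine V.smul_mem _ (V.sub_mem (hp _ hu) (hp _ ?_))
  simpa using hl

theorem main_K {n : ℕ} (K : Set (Fin n → ℂ)) [CompactSpace K]
    (V : Submodule ℂ C(K, ℂ)) (hV : IsClosed (V : Set C(K, ℂ)))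
    (U : Set (Fin n → ℂ)) (hU : IsOpen U) (hne : U.Nonempty)
    (hp : ∀ l ∈ U, restr n K (expE n l) ∈ V) (f : EntireSubmodule n) :
    restr n K f ∈ V := by
  have key : ∀ p ∈ Algebra.adjoin ℂ (Set.range (coordK K)),
      ∀ l ∈ U, restr n K (expE n l) * p ∈ V := by
    intro p hpA
    have : ∀ q : C(K, ℂ), (∀ l ∈ U, restr n K (expE n l) * q ∈ V) →
        ∀ l ∈ U, restr n K (expE n l) * (p * q) ∈ V := by
      induction hpA using Algebra.adjoin_induction with
      | mem x hx =>
        obtain ⟨i, rfl⟩ := hx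
        intro q hq
        exact deriv_step K V hV U hU q hq i
      | algebraMap r =>
        intro q hq l hl
        rw [← Algebra.smul_def, mul_smul_comm]
        exact V.smul_mem _ (hq l hl)
      | add x y _ _ hx hy =>
        intro q hq l hl
        rw [add_mul, mul_add]
        exact V.add_mem (hx q hq l hl) (hy q hq l hl)
      | mul x y _ _ hx hy =>
        intro q hq l hl
        rw [mul_assoc]
        exact hx _ (hy q hq) l hl
    intro l hl
    simpa using this 1 (by simpa using hp) l hl
  obtain ⟨l, hl⟩ := hne
  have key2 : ∀ p ∈ polyAlg K, restr n K (expE n l) * p ∈ V := by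
    intro p hpA
    have hcl : IsClosed {p : C(K, ℂ) | restr n K (expE n l) * p ∈ V} :=
      hV.preimage (continuous_const.mul continuous_id)
    exact closure_minimal (fun p hp => key p hp l hl) hcl hpA
  have hfd : Differentiable ℂ (f : (Fin n → ℂ) → ℂ) := f.2
  let g : EntireSubmodule n :=
    ⟨fun x => Complex.exp (-∑ i, l i * x i) * (f : (Fin n → ℂ) → ℂ) x, by
      change Differentiable ℂ _; fun_prop⟩
  have h := key2 _ (entire_mem K Finset.univ g
    (fun x y hxy => by rw [show x = y from funext fun i => hxy i (Finset.mem_univ i)]))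
  convert! h using 1
  ext x
  change (f : (Fin n → ℂ) → ℂ) x.1 = Complex.exp (∑ i, l i * x.1 i) *
    (Complex.exp (-∑ i, l i * x.1 i) * (f : (Fin n → ℂ) → ℂ) x.1)
  rw [← mul_assoc, ← Complex.exp_add]
  simp

/-- For every nonempty open set `U ⊆ ℂⁿ`, the span of the exponentials
`x ↦ exp (λ₁ x₁ + ⋯ + λₙ xₙ)` with `λ ∈ U` is dense in `H(ℂⁿ)` with the
compact-open topology. -/
theorem stmt14 (n : ℕ) (U : Set (Fin n → ℂ)) (hU : IsOpen U) (hne : U.Nonempty) :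
    Dense (↑(Submodule.span ℂ {f : EntireSubmodule n | ∃ l ∈ U,
        (f : (Fin n → ℂ) → ℂ) = fun x => Complex.exp (∑ i, l i * x i)}) :
      Set (EntireSubmodule n)) := by
  intro f
  have hb := ((UniformOnFun.hasBasis_nhds_of_basis (Fin n → ℂ) ℂ
    {K : Set (Fin n → ℂ) | IsCompact K}
    (UniformOnFun.ofFun {K : Set (Fin n → ℂ) | IsCompact K} (f : (Fin n → ℂ) → ℂ))
    ⟨∅, isCompact_empty⟩ (directedOn_of_sup_mem fun _ _ => IsCompact.union)
    Metric.uniformity_basis_dist).comap (fun f : EntireSubmodule n =>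
      UniformOnFun.ofFun {K : Set (Fin n → ℂ) | IsCompact K} (f : (Fin n → ℂ) → ℂ)))
  rw [← nhds_induced] at hb
  rw [mem_closure_iff_nhds_basis hb]
  rintro ⟨K, ε⟩ ⟨hK, hε⟩
  have hK : IsCompact K := hK
  have hε : 0 < ε := hε
  have : CompactSpace K := isCompact_iff_compactSpace.mp hK
  set S := Submodule.span ℂ {f : EntireSubmodule n | ∃ l ∈ U,
        (f : (Fin n → ℂ) → ℂ) = fun x => Complex.exp (∑ i, l i * x i)} with hS
  have hm := main_K K (S.map (restr n K)).topologicalClosure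
    (Submodule.isClosed_topologicalClosure _) U hU hne (fun l hl =>
      Submodule.le_topologicalClosure _ (Submodule.mem_map_of_mem
        (Submodule.subset_span ⟨l, hl, rfl⟩))) f
  obtain ⟨h, hh, hd⟩ := Metric.mem_closure_iff.mp hm ε hε
  obtain ⟨g, hg, rfl⟩ := hh
  refine ⟨g, hg, ?_⟩
  intro x hx
  have := (ContinuousMap.dist_lt_iff hε).mp hd ⟨x, hx⟩
  rw [dist_comm] at this
  exact this
end
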